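/- Let g be a rank-one isometry of a CAT(0) space X with A-contracting axis a, and let b be a B-contracting geodesic ray with b(0) = a(0) = p. Then for every n, the geodesic ray k_n = [p, gⁿ b(∞)) is K-contracting with Ψ(B̃, A) ≤ K ≤ Φ(A, B), where B̃ is the minimal contracting constant of b, Ψ(B̃, A) = (B̃ − 16A − 77δ_A − 38)/16 − 3, δ_A is the slimness constant of a, and Φ(A, B) is the concatenation constant. -/

import Mathlib

open Metric Set Filter

variable {X : Type*} [MetricSpace X]

/-- A metric space is CAT(0) if midpoints exist and satisfy the CN comparison inequality. -/
def IsCAT0 (X : Type*) [MetricSpace X] : Prop :=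
  ∀ x y : X, ∃ m : X, dist x m = dist x y / 2 ∧ dist y m = dist x y / 2 ∧
    ∀ z : X, dist z m ^ 2 ≤ (dist z x ^ 2 + dist z y ^ 2) / 2 - dist x y ^ 2 / 4

/-- A geodesic ray: isometric embedding of `[0, ∞)`. -/
def IsRay (c : ℝ → X) : Prop :=
  ∀ s t : ℝ, 0 ≤ s → 0 ≤ t → dist (c s) (c t) = |s - t|

/-- A bi-infinite geodesic: isometric embedding of `ℝ`. -/
def IsGeodesicLine (c : ℝ → X) : Prop :=
  ∀ s t : ℝ, dist (c s) (c t) = |s - t|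

/-- A geodesic segment from `y` to `z`, parametrized on `[0, dist y z]`. -/
def IsGeodesicSeg (g : ℝ → X) (y z : X) : Prop :=
  g 0 = y ∧ g (dist y z) = z ∧
    ∀ s t, s ∈ Icc 0 (dist y z) → t ∈ Icc 0 (dist y z) → dist (g s) (g t) = |s - t|

/-- `π` is a nearest-point projection onto the set `S`. -/
def IsProjOn (S : Set X) (π : X → X) : Prop :=
  ∀ p : X, π p ∈ S ∧ ∀ q ∈ S, dist p (π p) ≤ dist p q

/-- The set `S` (image of a geodesic) is `A`-contracting. -/
def ContractingSet (A : ℝ) (S : Set X) : Prop :=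
  ∃ π : X → X, IsProjOn S π ∧
    ∀ p q : X, dist p q < dist p (π p) → dist (π p) (π q) < A

/-- Slimness with respect to a given nearest-point projection `π` onto `S`:
every geodesic from `y` to a point `z ∈ S` passes within `δ` of `π y`. -/
def SlimWith (δ : ℝ) (S : Set X) (π : X → X) : Prop :=
  ∀ y z, z ∈ S → ∀ g : ℝ → X, IsGeodesicSeg g y z →
    ∃ s ∈ Icc (0:ℝ) (dist y z), dist (π y) (g s) ≤ δ

/-- The set `S` is `δ`-slim. -/
def SlimSet (δ : ℝ) (S : Set X) : Prop :=
  ∃ π : X → X, IsProjOn S π ∧ SlimWith δ S π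

/-- Two rays are asymptotic (bounded Hausdorff distance). -/
def Asymp (a b : ℝ → X) : Prop :=
  ∃ M : ℝ, ∀ t : ℝ, 0 ≤ t → dist (a t) (b t) ≤ M

/-- `e` divides the pair `x`, `y` in the ratio `t : 1 - t`. -/
def IsPt (t : ℝ) (x y e : X) : Prop :=
  dist x e ≤ t * dist x y ∧ dist e y ≤ (1 - t) * dist x y

section CAT0

theorem IsPt.symm {t : ℝ} {x y e : X} (h : IsPt t x y e) : IsPt (1 - t) y x e := by
  refine ⟨?_, ?_⟩
  · rw [dist_comm y e, dist_comm y x]; exact h.2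
  · rw [dist_comm e x, dist_comm y x]; simpa using h.1

theorem mem_of_isClosed_of_midpoint {T : Set ℝ} (hT : IsClosed T) (h0 : (0 : ℝ) ∈ T)
    (h1 : (1 : ℝ) ∈ T) (hmid : ∀ s ∈ T, ∀ t ∈ T, (s + t) / 2 ∈ T) {t : ℝ} (ht : t ∈ Icc (0 : ℝ) 1) :
    t ∈ T := by
  have hLc : IsClosed (T ∩ Iic t) := hT.inter isClosed_Iic
  have hRc : IsClosed (T ∩ Ici t) := hT.inter isClosed_Ici
  have hLb : BddAbove (T ∩ Iic t) := ⟨t, fun _ h => h.2⟩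
  have hRb : BddBelow (T ∩ Ici t) := ⟨t, fun _ h => h.2⟩
  have hl := hLc.csSup_mem ⟨0, h0, ht.1⟩ hLb
  have hr := hRc.csInf_mem ⟨1, h1, ht.2⟩ hRb
  set l := sSup (T ∩ Iic t)
  set r := sInf (T ∩ Ici t)
  have hm := hmid l hl.1 r hr.1
  have hlt : l ≤ t := hl.2
  have htr : t ≤ r := hr.2
  rcases le_total ((l + r) / 2) t with h | h
  · have : (l + r) / 2 ≤ l := le_csSup hLb ⟨hm, h⟩
    have : t = r := by linarith
    rw [this]; exact hr.1
  · have : r ≤ (l + r) / 2 := csInf_le hRb ⟨hm, h⟩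
    have : t = l := by linarith
    rw [this]; exact hl.1

theorem IsCAT0.exists_cn [CompleteSpace X] (hX : IsCAT0 X) (x y : X) {t : ℝ}
    (ht : t ∈ Icc (0 : ℝ) 1) :
    ∃ e : X, ∀ z, dist z e ^ 2 ≤
      (1 - t) * dist z x ^ 2 + t * dist z y ^ 2 - t * (1 - t) * dist x y ^ 2 := by
  set D := dist x y with hD
  have hD0 : 0 ≤ D := dist_nonneg
  let P : ℝ → X → Prop := fun t e => ∀ z, dist z e ^ 2 ≤
    (1 - t) * dist z x ^ 2 + t * dist z y ^ 2 - t * (1 - t) * D ^ 2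
  have hx : ∀ t e, 0 ≤ t → P t e → dist x e ≤ t * D := by
    intro t e h0 h
    have := h x
    rw [dist_self, ← hD] at this
    refine abs_le_of_sq_le_sq' ?_ (by positivity) |>.2
    nlinarith
  have hy : ∀ t e, t ≤ 1 → P t e → dist y e ≤ (1 - t) * D := by
    intro t e h0 h
    have := h y
    rw [dist_self, dist_comm y x, ← hD] at this
    refine abs_le_of_sq_le_sq' ?_ (mul_nonneg (by linarith) hD0) |>.2
    nlinarith
  have hst : ∀ s t e f, s ∈ Icc (0 : ℝ) 1 → t ∈ Icc (0 : ℝ) 1 → P s e → P t f →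
      dist e f ≤ |s - t| * D := by
    intro s t e f hs ht he hf
    have h1 := hx s e hs.1 he
    have h2 := hy s e hs.2 he
    have h3 := hf e
    rw [dist_comm e x, dist_comm e y] at h3
    have h4 : dist x e ^ 2 ≤ (s * D) ^ 2 := by gcongr
    have h5 : dist y e ^ 2 ≤ ((1 - s) * D) ^ 2 := by gcongr
    have h6 := mul_le_mul_of_nonneg_left h4 (sub_nonneg.2 ht.2)
    have h7 := mul_le_mul_of_nonneg_left h5 ht.1
    refine abs_le_of_sq_le_sq' ?_ (by positivity) |>.2
    rw [mul_pow, sq_abs]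
    nlinarith
  have key : t ∈ {t : ℝ | t ∈ Icc (0 : ℝ) 1 ∧ ∃ e, P t e} := by
    refine mem_of_isClosed_of_midpoint ?_ ?_ ?_ ?_ ht
    · refine isClosed_of_closure_subset fun τ hτ => ?_
      obtain ⟨u, hu, hlim⟩ := mem_closure_iff_seq_limit.1 hτ
      have hτ' : τ ∈ Icc (0 : ℝ) 1 :=
        isClosed_Icc.mem_of_tendsto hlim (Eventually.of_forall fun n => (hu n).1)
      choose hu1 e he using hu
      have hc : CauchySeq e := by
        have huc := hlim.cauchySeq
        rw [Metric.cauchySeq_iff'] at huc ⊢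
        intro ε hε
        obtain ⟨N, hN⟩ := huc (ε / (D + 1)) (by positivity)
        refine ⟨N, fun n hn => ?_⟩
        have h1 := hst _ _ _ _ (hu1 n) (hu1 N) (he n) (he N)
        have h2 := hN n hn
        rw [Real.dist_eq, lt_div_iff₀ (by positivity)] at h2
        nlinarith [abs_nonneg (u n - u N)]
      obtain ⟨f, hf⟩ := cauchySeq_tendsto_of_complete hc
      refine ⟨hτ', f, fun z => ?_⟩
      refine le_of_tendsto_of_tendsto (((tendsto_const_nhds (x := z)).dist hf).pow 2) ?_
        (Eventually.of_forall fun n => he n z)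
      have hcont : Continuous fun t : ℝ =>
          (1 - t) * dist z x ^ 2 + t * dist z y ^ 2 - t * (1 - t) * D ^ 2 := by fun_prop
      exact (hcont.tendsto τ).comp hlim
    · exact ⟨by simp, x, fun z => by simp⟩
    · exact ⟨by simp, y, fun z => by simp⟩
    · rintro s ⟨hs, e, he⟩ t ⟨ht, f, hf⟩
      refine ⟨⟨by linarith [hs.1, ht.1], by linarith [hs.2, ht.2]⟩, ?_⟩
      obtain ⟨m, -, -, hm⟩ := hX e f
      refine ⟨m, fun z => ?_⟩
      have h1 := he z
      have h2 := hf z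
      have h3 := hm z
      have h4 : (s - t) ^ 2 * D ^ 2 ≤ dist e f ^ 2 := by
        have a1 := hx s e hs.1 he
        have a2 := hy t f ht.2 hf
        have a3 := hx t f ht.1 hf
        have a4 := hy s e hs.2 he
        have a5 : D ≤ dist x e + dist e f + dist f y := dist_triangle4 _ _ _ _
        have a6 : D ≤ dist x f + dist f e + dist e y := dist_triangle4 _ _ _ _
        rw [dist_comm f y] at a5
        rw [dist_comm f e, dist_comm e y] at a6
        rw [← mul_pow]
        apply sq_le_sq'
        · nlinarith
        · nlinarith
      nlinarith
  exact key.2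

theorem IsPt.cn [CompleteSpace X] (hX : IsCAT0 X) {x y e : X} {t : ℝ} (ht : t ∈ Icc (0 : ℝ) 1)
    (h : IsPt t x y e) (z : X) : dist z e ^ 2 ≤
      (1 - t) * dist z x ^ 2 + t * dist z y ^ 2 - t * (1 - t) * dist x y ^ 2 := by
  obtain ⟨f, hf⟩ := hX.exists_cn x y ht
  suffices e = f by rw [this]; exact hf z
  have h1 := hf e
  have h2 : dist e x ^ 2 ≤ (t * dist x y) ^ 2 := by rw [dist_comm e x]; gcongr; exact h.1
  have h3 : dist e y ^ 2 ≤ ((1 - t) * dist x y) ^ 2 := by gcongr; exact h.2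
  have h4 := mul_le_mul_of_nonneg_left h2 (sub_nonneg.2 ht.2)
  have h5 := mul_le_mul_of_nonneg_left h3 ht.1
  have h6 : dist e f ^ 2 ≤ 0 := by nlinarith
  have := sq_nonneg (dist e f)
  exact dist_eq_zero.1 (pow_eq_zero_iff two_ne_zero |>.1 (le_antisymm h6 this))

theorem IsCAT0.exists_isPt [CompleteSpace X] (hX : IsCAT0 X) (x y : X) {t : ℝ}
    (ht : t ∈ Icc (0 : ℝ) 1) : ∃ e : X, IsPt t x y e := by
  obtain ⟨e, he⟩ := hX.exists_cn x y ht
  have h1 := he x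
  have h2 := he y
  rw [dist_self] at h1 h2
  rw [dist_comm y x] at h2
  refine ⟨e, ?_, ?_⟩
  · refine abs_le_of_sq_le_sq' ?_ (mul_nonneg ht.1 dist_nonneg) |>.2
    nlinarith
  · rw [dist_comm e y]
    refine abs_le_of_sq_le_sq' ?_ (mul_nonneg (sub_nonneg.2 ht.2) dist_nonneg) |>.2
    nlinarith

theorem IsPt.unique [CompleteSpace X] (hX : IsCAT0 X) {x y e f : X} {t : ℝ}
    (ht : t ∈ Icc (0 : ℝ) 1) (he : IsPt t x y e) (hf : IsPt t x y f) : e = f := by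
  have h1 := hf.cn hX ht e
  have h2 : dist e x ^ 2 ≤ (t * dist x y) ^ 2 := by rw [dist_comm e x]; gcongr; exact he.1
  have h3 : dist e y ^ 2 ≤ ((1 - t) * dist x y) ^ 2 := by gcongr; exact he.2
  have h4 := mul_le_mul_of_nonneg_left h2 (sub_nonneg.2 ht.2)
  have h5 := mul_le_mul_of_nonneg_left h3 ht.1
  have h6 : dist e f ^ 2 ≤ 0 := by nlinarith
  exact dist_eq_zero.1 (pow_eq_zero_iff two_ne_zero |>.1 (le_antisymm h6 (sq_nonneg _)))

theorem IsPt.dist_le_of_left [CompleteSpace X] (hX : IsCAT0 X) {x y y' e e' : X} {t : ℝ}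
    (ht : t ∈ Icc (0 : ℝ) 1) (he : IsPt t x y e) (he' : IsPt t x y' e') :
    dist e e' ≤ t * dist y y' := by
  have h1 := he'.cn hX ht e
  have h2 := he.cn hX ht y'
  rw [dist_comm y' e, dist_comm y' x, dist_comm y' y] at h2
  have h3 : dist e x ^ 2 ≤ (t * dist x y) ^ 2 := by rw [dist_comm e x]; gcongr; exact he.1
  have h4 := mul_le_mul_of_nonneg_left h3 (sub_nonneg.2 ht.2)
  have h5 := mul_le_mul_of_nonneg_left h2 ht.1
  refine abs_le_of_sq_le_sq' ?_ (mul_nonneg ht.1 dist_nonneg) |>.2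
  nlinarith

/-- Convexity of the metric. -/
theorem IsPt.dist_le [CompleteSpace X] (hX : IsCAT0 X) {x y x' y' e e' : X} {t : ℝ}
    (ht : t ∈ Icc (0 : ℝ) 1) (he : IsPt t x y e) (he' : IsPt t x' y' e') :
    dist e e' ≤ (1 - t) * dist x x' + t * dist y y' := by
  obtain ⟨f, hf⟩ := hX.exists_isPt x y' ht
  have ht' : 1 - t ∈ Icc (0 : ℝ) 1 := ⟨by linarith [ht.2], by linarith [ht.1]⟩
  have h1 := he.dist_le_of_left hX ht hf
  have h2 := hf.symm.dist_le_of_left hX ht' he'.symm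
  linarith [dist_triangle e f e']

theorem IsCAT0.exists_geodesicSeg [CompleteSpace X] (hX : IsCAT0 X) (x y : X) :
    ∃ c : ℝ → X, IsGeodesicSeg c x y := by
  rcases eq_or_ne x y with rfl | hxy
  · refine ⟨fun _ => x, rfl, rfl, fun s t hs ht => ?_⟩
    simp only [dist_self, Icc_self, mem_singleton_iff] at hs ht
    simp [hs, ht]
  have hD : 0 < dist x y := dist_pos.2 hxy
  set D := dist x y with hDdef
  have hmem : ∀ {s}, s ∈ Icc 0 D → s / D ∈ Icc (0 : ℝ) 1 := fun hs =>
    ⟨div_nonneg hs.1 hD.le, (div_le_one hD).2 hs.2⟩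
  have hex : ∀ s, ∃ e, s ∈ Icc 0 D → IsPt (s / D) x y e := by
    intro s
    by_cases hs : s ∈ Icc 0 D
    · obtain ⟨e, he⟩ := hX.exists_isPt x y (hmem hs)
      exact ⟨e, fun _ => he⟩
    · exact ⟨x, fun h => absurd h hs⟩
  choose c hc using hex
  have hdist : ∀ s ∈ Icc 0 D, dist x (c s) ≤ s ∧ dist (c s) y ≤ D - s := by
    intro s hs
    have := hc s hs
    refine ⟨this.1.trans_eq ?_, this.2.trans_eq ?_⟩ <;> rw [← hDdef] <;> field_simp
  have hle : ∀ s ∈ Icc 0 D, ∀ t ∈ Icc 0 D, s ≤ t → dist (c s) (c t) = t - s := by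
    intro s hs t ht hst
    have hs' := hdist s hs
    have ht' := hdist t ht
    have htri := dist_triangle4 x (c s) (c t) y
    rw [← hDdef] at htri
    refine le_antisymm ?_ (by linarith)
    rcases ht.1.eq_or_lt with h0 | h0
    · have : s = t := by linarith [hs.1]
      subst this
      simp
    have hst1 : s / t ∈ Icc (0 : ℝ) 1 := ⟨div_nonneg hs.1 h0.le, (div_le_one h0).2 hst⟩
    obtain ⟨e, he1, he2⟩ := hX.exists_isPt x (c t) hst1
    have h1 : dist x e ≤ s := he1.trans (by
      calc s / t * dist x (c t) ≤ s / t * t := mul_le_mul_of_nonneg_left ht'.1 hst1.1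
        _ = s := by field_simp)
    have h2 : dist e (c t) ≤ t - s := he2.trans (by
      calc (1 - s / t) * dist x (c t) ≤ (1 - s / t) * t :=
            mul_le_mul_of_nonneg_left ht'.1 (by linarith [hst1.2])
        _ = t - s := by field_simp)
    have he : IsPt (s / D) x y e := by
      refine ⟨h1.trans_eq (by rw [← hDdef]; field_simp), ?_⟩
      have : dist e y ≤ D - s := by linarith [dist_triangle e (c t) y]
      exact this.trans_eq (by rw [← hDdef]; field_simp)
    rwa [(hc s hs).unique hX (hmem hs) he]
  have h0 : (0 : ℝ) ∈ Icc 0 D := ⟨le_rfl, hD.le⟩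
  have h1 : D ∈ Icc 0 D := ⟨hD.le, le_rfl⟩
  refine ⟨c, ?_, ?_, fun s t hs ht => ?_⟩
  · exact (dist_le_zero.1 (hdist 0 h0).1).symm
  · exact dist_le_zero.1 (by simpa using (hdist D h1).2)
  · rcases le_total s t with h | h
    · rw [hle s hs t ht h, abs_of_nonpos (by linarith)]; ring
    · rw [dist_comm, hle t ht s hs h, abs_of_nonneg (by linarith)]

end CAT0

section Contracting

/-- `v` is a point of `S` nearest to `z`. -/
def IsNearest (S : Set X) (z v : X) : Prop :=
  v ∈ S ∧ ∀ s ∈ S, dist z v ≤ dist z s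

/-- Contraction expressed through nearest points, without choosing a projection. -/
def NearestContracting (C : ℝ) (S : Set X) : Prop :=
  ∀ z z' v v', IsNearest S z v → IsNearest S z' v' → dist z z' < dist z v → dist v v' < C

/-- `S` contains all geodesics between its points. -/
def GeodConvex (S : Set X) : Prop :=
  ∀ x ∈ S, ∀ y ∈ S, ∀ t ∈ Icc (0 : ℝ) 1, ∃ e ∈ S, IsPt t x y e

/-- `c` is an isometric embedding on `I`. -/
def IsoOn (c : ℝ → X) (I : Set ℝ) : Prop :=
  ∀ s ∈ I, ∀ t ∈ I, dist (c s) (c t) = |s - t|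

theorem IsNearest.sq_add_sq_le [CompleteSpace X] (hX : IsCAT0 X) {S : Set X} (hS : GeodConvex S)
    {z v s : X} (hv : IsNearest S z v) (hs : s ∈ S) :
    dist z v ^ 2 + dist v s ^ 2 ≤ dist z s ^ 2 := by
  have key : ∀ t ∈ Ioc (0 : ℝ) 1, (1 - t) * dist v s ^ 2 ≤ dist z s ^ 2 - dist z v ^ 2 := by
    intro t ht
    have ht' : t ∈ Icc (0 : ℝ) 1 := ⟨ht.1.le, ht.2⟩
    obtain ⟨e, he, hpt⟩ := hS v hv.1 s hs t ht'
    have h1 := hpt.cn hX ht' z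
    have h2 : dist z v ^ 2 ≤ dist z e ^ 2 := by
      have := hv.2 e he
      gcongr
    have h3 : t * ((1 - t) * dist v s ^ 2) ≤ t * (dist z s ^ 2 - dist z v ^ 2) := by nlinarith
    exact le_of_mul_le_mul_left h3 ht.1
  by_contra! h
  have hm : 0 ≤ dist z s ^ 2 - dist z v ^ 2 := by simpa using key 1 (by simp)
  have hpos : 0 < dist v s ^ 2 := by linarith
  set q := dist v s ^ 2
  set d := dist z s ^ 2 - dist z v ^ 2 with hd
  have hdq : d < q := by linarith
  have h1 := key ((q - d) / (2 * q)) ⟨by apply div_pos <;> linarith, by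
    rw [div_le_one (by linarith)]; linarith⟩
  have h2 : (1 - (q - d) / (2 * q)) * q = (q + d) / 2 := by field_simp; ring
  linarith

theorem IsNearest.dist_le [CompleteSpace X] (hX : IsCAT0 X) {S : Set X} (hS : GeodConvex S)
    {z z' v v' : X} (hv : IsNearest S z v) (hv' : IsNearest S z' v') :
    dist v v' ≤ dist z z' := by
  have h1 := hv.sq_add_sq_le hX hS hv'.1
  have h2 := hv'.sq_add_sq_le hX hS hv.1
  have hhalf : (1 / 2 : ℝ) ∈ Icc (0 : ℝ) 1 := by norm_num
  obtain ⟨e, he⟩ := hX.exists_isPt z v' hhalf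
  have h3 := he.cn hX hhalf z'
  have h4 := he.cn hX hhalf v
  have h5 : dist z' v ^ 2 ≤ (dist z' e + dist v e) ^ 2 := by
    have := dist_triangle_right z' v e
    gcongr
  rw [dist_comm v' v] at h2
  rw [dist_comm z' z] at h3
  rw [dist_comm v z] at h4
  refine abs_le_of_sq_le_sq' ?_ dist_nonneg |>.2
  nlinarith [sq_nonneg (dist z' e - dist v e)]

theorem IsNearest.unique [CompleteSpace X] (hX : IsCAT0 X) {S : Set X} (hS : GeodConvex S)
    {z v v' : X} (hv : IsNearest S z v) (hv' : IsNearest S z v') : v = v' :=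
  dist_le_zero.1 (by simpa using hv.dist_le hX hS hv')

theorem IsNearest.mono {S S' : Set X} {z v : X} (hv : IsNearest S z v) (h : S' ⊆ S)
    (hmem : v ∈ S') : IsNearest S' z v :=
  ⟨hmem, fun s hs => hv.2 s (h hs)⟩

theorem ContractingSet.nearestContracting [CompleteSpace X] (hX : IsCAT0 X) {S : Set X}
    (hS : GeodConvex S) {C : ℝ} (h : ContractingSet C S) : NearestContracting C S := by
  obtain ⟨π, hπ, hC⟩ := h
  intro z z' v v' hv hv' hlt
  rw [hv.unique hX hS (hπ z)] at hlt ⊢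
  rw [hv'.unique hX hS (hπ z')]
  exact hC z z' hlt

theorem NearestContracting.contractingSet {S : Set X} {C : ℝ} (h : NearestContracting C S)
    (hex : ∀ z, ∃ v, IsNearest S z v) : ContractingSet C S := by
  choose π hπ using hex
  exact ⟨π, hπ, fun p q hlt => h p q _ _ (hπ p) (hπ q) hlt⟩

theorem NearestContracting.mono {S : Set X} {C C' : ℝ} (h : NearestContracting C S)
    (hC : C ≤ C') : NearestContracting C' S :=
  fun z z' v v' hv hv' hlt => (h z z' v v' hv hv' hlt).trans_le hC

/-- Moving a point by little more than its distance to a contracting set moves its projection by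
little more than the contraction constant. -/
theorem NearestContracting.dist_le_add [CompleteSpace X] (hX : IsCAT0 X) {S : Set X}
    (hS : GeodConvex S) (hex : ∀ z, ∃ v, IsNearest S z v) {B : ℝ} (hB : 0 < B)
    (h : NearestContracting B S) {z e v w : X} (hv : IsNearest S z v) (hw : IsNearest S e w)
    {c : ℝ} (hc : 0 ≤ c) (hze : dist z e ≤ dist z v + c) : dist v w ≤ B + c := by
  refine le_of_forall_pos_le_add fun ε hε => ?_
  rcases le_or_gt (dist z v) ε with hr | hr
  · linarith [hv.dist_le hX hS hw]
  rcases lt_or_ge (dist z e) (dist z v) with hlt | hge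
  · linarith [h z e v w hv hw hlt]
  have hD : 0 < dist z e := by linarith
  have ht : (dist z v - ε) / dist z e ∈ Icc (0 : ℝ) 1 :=
    ⟨div_nonneg (by linarith) hD.le, (div_le_one hD).2 (by linarith)⟩
  obtain ⟨f, hf1, hf2⟩ := hX.exists_isPt z e ht
  obtain ⟨u, hu⟩ := hex f
  rw [div_mul_cancel₀ _ hD.ne'] at hf1
  rw [sub_mul, div_mul_cancel₀ _ hD.ne'] at hf2
  have h1 := h z f v u hv hu (by linarith)
  have h2 := hu.dist_le hX hS hw
  linarith [dist_triangle v u w]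

/-- A convex set at finite Hausdorff distance from a contracting set is contracting. -/
theorem NearestContracting.of_hausdorff [CompleteSpace X] (hX : IsCAT0 X) {S K : Set X}
    (hS : GeodConvex S) (hex : ∀ z, ∃ v, IsNearest S z v) {B c : ℝ} (hB : 0 < B) (hc : 0 ≤ c)
    (h : NearestContracting B S) (hSK : ∀ s ∈ S, ∃ κ ∈ K, dist s κ ≤ c)
    (hKS : ∀ κ ∈ K, ∃ s ∈ S, dist κ s ≤ c) : NearestContracting (3 * B + 5 * c + 1) K := by
  have hK : ∀ z v x, IsNearest K z v → IsNearest S z x → dist z v ≤ dist z x + c := by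
    intro z v x hv hx
    obtain ⟨κ, hκ, hd⟩ := hSK x hx.1
    linarith [hv.2 κ hκ, dist_triangle z x κ]
  have hKn : ∀ κ ∈ K, ∃ s, IsNearest S κ s ∧ dist κ s ≤ c := by
    intro κ hκ
    obtain ⟨s, hs⟩ := hex κ
    obtain ⟨s', hs', hd⟩ := hKS κ hκ
    exact ⟨s, hs, (hs.2 s' hs').trans hd⟩
  intro z z' v w hv hw hlt
  obtain ⟨x, hx⟩ := hex z
  obtain ⟨x', hx'⟩ := hex z'
  obtain ⟨v', hv', hdv⟩ := hKn v hv.1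
  obtain ⟨w', hw', hdw⟩ := hKn w hw.1
  have h1 := h.dist_le_add hX hS hex hB hx hv' hc (hK z v x hv hx)
  have h2 := h.dist_le_add hX hS hex hB hx hx' hc (hlt.le.trans (hK z v x hv hx))
  have h3 := h.dist_le_add hX hS hex hB hx' hw' hc (hK z' w x' hw hx')
  have h4 := dist_triangle4 v v' x w
  have h5 := dist_triangle4 x x' w' w
  rw [dist_comm v' x] at h4
  rw [dist_comm w' w] at h5
  linarith

theorem IsoOn.mono {c : ℝ → X} {I J : Set ℝ} (h : IsoOn c I) (hJ : J ⊆ I) : IsoOn c J :=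
  fun s hs t ht => h s (hJ hs) t (hJ ht)

theorem IsoOn.comp_neg {c : ℝ → X} {I : Set ℝ} (h : IsoOn c I) :
    IsoOn (fun t => c (-t)) (Neg.neg '' I) := by
  rintro _ ⟨s, hs, rfl⟩ _ ⟨t, ht, rfl⟩
  simp only [neg_neg, h s hs t ht]
  rw [abs_sub_comm]
  congr 1
  ring

theorem image_comp_neg {Y : Type*} (c : ℝ → Y) (I : Set ℝ) :
    (fun t => c (-t)) '' (Neg.neg '' I) = c '' I := by
  rw [image_image]
  simp only [neg_neg]

theorem IsoOn.isPt {c : ℝ → X} {I : Set ℝ} (h : IsoOn c I) {s t l : ℝ} (hs : s ∈ I) (ht : t ∈ I)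
    (hl : l ∈ Icc (0 : ℝ) 1) (hu : (1 - l) * s + l * t ∈ I) :
    IsPt l (c s) (c t) (c ((1 - l) * s + l * t)) := by
  constructor
  · rw [h _ hs _ hu, h _ hs _ ht,
      show s - ((1 - l) * s + l * t) = l * (s - t) by ring, abs_mul, abs_of_nonneg hl.1]
  · rw [h _ hu _ ht, h _ hs _ ht,
      show (1 - l) * s + l * t - t = (1 - l) * (s - t) by ring, abs_mul,
      abs_of_nonneg (sub_nonneg.2 hl.2)]

theorem convexComb_mem {I : Set ℝ} (hI : I.OrdConnected) {s t l : ℝ} (hs : s ∈ I) (ht : t ∈ I)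
    (hl : l ∈ Icc (0 : ℝ) 1) : (1 - l) * s + l * t ∈ I :=
  hI.convex hs ht (sub_nonneg.2 hl.2) hl.1 (by ring)

theorem exists_convexComb_eq {s t u : ℝ} (hsu : s ≤ u) (hut : u ≤ t) :
    ∃ l ∈ Icc (0 : ℝ) 1, (1 - l) * s + l * t = u := by
  rcases hsu.eq_or_lt with rfl | h
  · exact ⟨0, by simp, by simp⟩
  · have : 0 < t - s := by linarith
    refine ⟨(u - s) / (t - s), ⟨div_nonneg (by linarith) this.le,
      (div_le_one this).2 (by linarith)⟩, ?_⟩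
    field_simp
    ring

theorem IsoOn.geodConvex {c : ℝ → X} {I : Set ℝ} (h : IsoOn c I) (hI : I.OrdConnected) :
    GeodConvex (c '' I) := by
  rintro _ ⟨s, hs, rfl⟩ _ ⟨t, ht, rfl⟩ l hl
  have hu := convexComb_mem hI hs ht hl
  exact ⟨_, ⟨_, hu, rfl⟩, h.isPt hs ht hl hu⟩

theorem IsoOn.exists_isNearest [ProperSpace X] {c : ℝ → X} {I : Set ℝ} (h : IsoOn c I)
    (hI : IsClosed I) (hne : I.Nonempty) (z : X) : ∃ v, IsNearest (c '' I) z v := by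
  have : CompleteSpace I := hI.completeSpace_coe
  have hiso : Isometry (I.domRestrict c) := Isometry.of_dist_eq fun s t => h s s.2 t t.2
  have hcl : IsClosed (c '' I) := by
    rw [← range_domRestrict]
    exact hiso.isClosedEmbedding.isClosed_range
  obtain ⟨v, hv, hd⟩ := hcl.exists_infDist_eq_dist (hne.image c) z
  exact ⟨v, hv, fun s hs => hd ▸ infDist_le_dist_of_mem hs⟩

/-- The distance to a geodesic increases away from the nearest point. -/
theorem IsoOn.dist_le_of_isNearest [CompleteSpace X] (hX : IsCAT0 X) {c : ℝ → X} {I : Set ℝ}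
    (h : IsoOn c I) (hI : I.OrdConnected) {z : X} {s t l : ℝ} (ht : t ∈ I)
    (hz : IsNearest (c '' I) z (c t)) (hs : s ∈ I) (hl : l ∈ Icc (0 : ℝ) 1) :
    dist z (c ((1 - l) * t + l * s)) ≤ dist z (c s) := by
  have h1 := (h.isPt ht hs hl (convexComb_mem hI ht hs hl)).cn hX hl z
  have h2 := hz.2 _ (mem_image_of_mem c hs)
  have h3 : dist z (c t) ^ 2 ≤ dist z (c s) ^ 2 := by gcongr
  have h4 := mul_le_mul_of_nonneg_left h3 (sub_nonneg.2 hl.2)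
  have h5 := mul_nonneg (mul_nonneg hl.1 (sub_nonneg.2 hl.2)) (sq_nonneg (dist (c t) (c s)))
  refine abs_le_of_sq_le_sq' ?_ dist_nonneg |>.2
  linarith

theorem IsoOn.isNearest_max [CompleteSpace X] (hX : IsCAT0 X) {c : ℝ → X} {I : Set ℝ}
    (h : IsoOn c I) (hI : I.OrdConnected) {z : X} {t α : ℝ} (ht : t ∈ I) (hα : α ∈ I)
    (hz : IsNearest (c '' I) z (c t)) :
    IsNearest (c '' (I ∩ Ici α)) z (c (max t α)) := by
  rcases le_total α t with hle | hle
  · rw [max_eq_left hle]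
    exact hz.mono (image_mono inter_subset_left) ⟨t, ⟨ht, hle⟩, rfl⟩
  · rw [max_eq_right hle]
    refine ⟨⟨α, ⟨hα, le_refl α⟩, rfl⟩, ?_⟩
    rintro _ ⟨s, ⟨hs, hαs⟩, rfl⟩
    obtain ⟨l, hl, rfl⟩ := exists_convexComb_eq hle hαs
    exact h.dist_le_of_isNearest hX hI ht hz hs hl

theorem image_neg_inter_Ici (I : Set ℝ) (α : ℝ) :
    Neg.neg '' (I ∩ Iic α) = Neg.neg '' I ∩ Ici (-α) := by
  ext x
  simp [and_comm]

theorem ordConnected_image_neg {I : Set ℝ} (hI : I.OrdConnected) :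
    (Neg.neg '' I).OrdConnected := by
  rw [image_neg_eq_neg]
  exact ⟨fun x hx y hy z hz => hI.out hy hx ⟨neg_le_neg hz.2, neg_le_neg hz.1⟩⟩

theorem IsoOn.isNearest_min [CompleteSpace X] (hX : IsCAT0 X) {c : ℝ → X} {I : Set ℝ}
    (h : IsoOn c I) (hI : I.OrdConnected) {z : X} {t α : ℝ} (ht : t ∈ I) (hα : α ∈ I)
    (hz : IsNearest (c '' I) z (c t)) :
    IsNearest (c '' (I ∩ Iic α)) z (c (min t α)) := by
  have := h.comp_neg.isNearest_max hX (ordConnected_image_neg hI) (z := z) (t := -t) (α := -α)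
    ⟨t, ht, rfl⟩ ⟨α, hα, rfl⟩ (by rw [image_comp_neg, neg_neg]; exact hz)
  rw [← image_neg_inter_Ici, image_comp_neg] at this
  simpa [max_neg_neg] using this

/-- Two contracting pieces of a geodesic give a contracting geodesic. -/
theorem NearestContracting.concat [CompleteSpace X] (hX : IsCAT0 X) {c : ℝ → X} {I : Set ℝ}
    (h : IsoOn c I) (hI : I.OrdConnected) {α C₁ C₂ : ℝ} (hα : α ∈ I)
    (h₁ : NearestContracting C₁ (c '' (I ∩ Iic α)))
    (h₂ : NearestContracting C₂ (c '' (I ∩ Ici α))) :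
    NearestContracting (C₁ + C₂) (c '' I) := by
  rintro z z' _ _ hz hz' hlt
  obtain ⟨t, ht, rfl⟩ := hz.1
  obtain ⟨t', ht', rfl⟩ := hz'.1
  have hmem : ∀ s ∈ I, min s α ∈ I ∧ max s α ∈ I := fun s hs =>
    ⟨by rcases min_choice s α with e | e <;> rwa [e],
      by rcases max_choice s α with e | e <;> rwa [e]⟩
  have hL := h₁ z z' _ _ (h.isNearest_min hX hI ht hα hz) (h.isNearest_min hX hI ht' hα hz')
    (hlt.trans_le (hz.2 _ ⟨_, (hmem t ht).1, rfl⟩))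
  have hR := h₂ z z' _ _ (h.isNearest_max hX hI ht hα hz) (h.isNearest_max hX hI ht' hα hz')
    (hlt.trans_le (hz.2 _ ⟨_, (hmem t ht).2, rfl⟩))
  rw [h _ (hmem t ht).1 _ (hmem t' ht').1] at hL
  rw [h _ (hmem t ht).2 _ (hmem t' ht').2] at hR
  rw [h _ ht _ ht']
  have e : t - t' = (min t α - min t' α) + (max t α - max t' α) := by
    linarith [min_add_max t α, min_add_max t' α]
  rw [e]
  linarith [abs_add_le (min t α - min t' α) (max t α - max t' α)]

/-- The projection takes every intermediate value along a path between two points. -/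
theorem IsoOn.exists_isNearest_eq [ProperSpace X] (hX : IsCAT0 X) {c : ℝ → X} {I : Set ℝ}
    (h : IsoOn c I) (hI : I.OrdConnected) (hIc : IsClosed I) {z z' : X} {s s' α : ℝ}
    (hs : s ∈ I) (hs' : s' ∈ I) (hz : IsNearest (c '' I) z (c s))
    (hz' : IsNearest (c '' I) z' (c s')) (h1 : s ≤ α) (h2 : α ≤ s') :
    ∃ e, IsNearest (c '' I) e (c α) ∧ dist z e + dist e z' = dist z z' := by
  obtain ⟨γ, hγ0, hγ1, hγ⟩ := hX.exists_geodesicSeg z z'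
  have hconv := h.geodConvex hI
  have hex : ∀ y, ∃ t ∈ I, IsNearest (c '' I) y (c t) := by
    intro y
    obtain ⟨v, hv⟩ := h.exists_isNearest hIc ⟨s, hs⟩ y
    obtain ⟨t, ht, rfl⟩ := hv.1
    exact ⟨t, ht, hv⟩
  choose τ hτI hτ using hex
  have huniq : ∀ y t, t ∈ I → IsNearest (c '' I) y (c t) → τ y = t := by
    intro y t ht hy
    have := (hτ y).unique hX hconv hy
    have h3 := h _ (hτI y) _ ht
    rw [this, dist_self] at h3
    linarith [abs_eq_zero.1 h3.symm]
  have hD : (0 : ℝ) ≤ dist z z' := dist_nonneg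
  have hcont : ContinuousOn (fun r => τ (γ r)) (Icc 0 (dist z z')) := by
    refine LipschitzOnWith.continuousOn (K := 1) (LipschitzOnWith.of_dist_le_mul ?_)
    intro r hr r' hr'
    have h3 := (hτ (γ r)).dist_le hX hconv (hτ (γ r'))
    rw [h _ (hτI _) _ (hτI _), hγ r r' hr hr'] at h3
    simpa [Real.dist_eq] using h3
  have hivt := intermediate_value_Icc hD hcont
  simp only [hγ0, hγ1, huniq z s hs hz, huniq z' s' hs' hz'] at hivt
  obtain ⟨r, hr, hrα⟩ := hivt ⟨h1, h2⟩
  refine ⟨γ r, hrα ▸ hτ (γ r), ?_⟩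
  have h3 := hγ 0 r ⟨le_rfl, hD⟩ hr
  have h4 := hγ r _ hr ⟨hD, le_rfl⟩
  rw [hγ0] at h3
  rw [hγ1] at h4
  rw [h3, h4, abs_of_nonpos (by linarith [hr.1]), abs_of_nonpos (by linarith [hr.2])]
  ring

/-- Subsegments of contracting geodesics are contracting with the same constant. -/
theorem NearestContracting.inter_Ici [ProperSpace X] (hX : IsCAT0 X) {c : ℝ → X} {I : Set ℝ}
    (h : IsoOn c I) (hI : I.OrdConnected) (hIc : IsClosed I) {α C : ℝ} (hC : 0 < C) (hα : α ∈ I)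
    (hcon : NearestContracting C (c '' I)) : NearestContracting C (c '' (I ∩ Ici α)) := by
  intro z z' v v' hv hv' hlt
  obtain ⟨_, hs⟩ := h.exists_isNearest hIc ⟨α, hα⟩ z
  obtain ⟨_, hs'⟩ := h.exists_isNearest hIc ⟨α, hα⟩ z'
  obtain ⟨s, hsI, rfl⟩ := hs.1
  obtain ⟨s', hsI', rfl⟩ := hs'.1
  have hconv : GeodConvex (c '' (I ∩ Ici α)) :=
    (h.mono inter_subset_left).geodConvex (hI.inter ordConnected_Ici)
  have e := hv.unique hX hconv (h.isNearest_max hX hI hsI hα hs)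
  have e' := hv'.unique hX hconv (h.isNearest_max hX hI hsI' hα hs')
  subst e e'
  have hmem : ∀ s ∈ I, max s α ∈ I := fun s hs => by
    rcases max_choice s α with e | e <;> rwa [e]
  rcases le_total α s with hαs | hsα
  · rw [max_eq_left hαs] at hlt
    have h1 := hcon z z' _ _ hs hs' hlt
    rw [h _ hsI _ hsI'] at h1
    rw [h _ (hmem s hsI) _ (hmem s' hsI')]
    exact (abs_max_sub_max_le_abs _ _ _).trans_lt h1
  · rw [max_eq_right hsα] at hlt ⊢
    rcases le_total α s' with hαs' | hsα'
    · rw [max_eq_left hαs']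
      obtain ⟨y, hy, hyd⟩ := h.exists_isNearest_eq hX hI hIc hsI hsI' hs hs' hsα hαs'
      exact hcon y z' _ _ hy hs' (by linarith [dist_triangle z y (c α)])
    · rw [max_eq_right hsα', dist_self]
      exact hC

theorem NearestContracting.inter_Iic [ProperSpace X] (hX : IsCAT0 X) {c : ℝ → X} {I : Set ℝ}
    (h : IsoOn c I) (hI : I.OrdConnected) (hIc : IsClosed I) {α C : ℝ} (hC : 0 < C) (hα : α ∈ I)
    (hcon : NearestContracting C (c '' I)) : NearestContracting C (c '' (I ∩ Iic α)) := by
  rw [← image_comp_neg, image_neg_inter_Ici]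
  refine NearestContracting.inter_Ici hX h.comp_neg (ordConnected_image_neg hI) ?_ hC
    ⟨α, hα, rfl⟩ (by rwa [image_comp_neg])
  rw [image_neg_eq_neg]
  exact hIc.neg

end Contracting

section Rays

theorem IsGeodesicLine.isoOn {c : ℝ → X} (h : IsGeodesicLine c) (I : Set ℝ) : IsoOn c I :=
  fun s _ t _ => h s t

theorem IsRay.isoOn {c : ℝ → X} (h : IsRay c) : IsoOn c (Ici 0) :=
  fun s hs t ht => h s t hs ht

theorem Asymp.symm {b c : ℝ → X} (h : Asymp b c) : Asymp c b := by
  obtain ⟨M, hM⟩ := h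
  exact ⟨M, fun t ht => dist_comm (b t) (c t) ▸ hM t ht⟩

theorem Isometry.isRay {h : X → X} (hh : Isometry h) {c : ℝ → X} (hc : IsRay c) :
    IsRay (fun t => h (c t)) :=
  fun s t hs ht => by rw [hh.dist_eq, hc s t hs ht]

theorem Isometry.isNearest_image_iff {h : X → X} (hh : Isometry h) {S : Set X} {z v : X} :
    IsNearest (h '' S) (h z) (h v) ↔ IsNearest S z v := by
  simp [IsNearest, hh.injective.mem_set_image, hh.dist_eq]

theorem Isometry.nearestContracting_image_iff {h : X → X} (hh : Isometry h)
    (hsurj : Function.Surjective h) {C : ℝ} {S : Set X} :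
    NearestContracting C (h '' S) ↔ NearestContracting C S := by
  constructor
  · intro H z z' v v' hv hv' hlt
    rw [← hh.dist_eq v v']
    exact H _ _ _ _ (hh.isNearest_image_iff.2 hv) (hh.isNearest_image_iff.2 hv')
      (by rwa [hh.dist_eq, hh.dist_eq])
  · intro H z z' v v' hv hv' hlt
    obtain ⟨z, rfl⟩ := hsurj z
    obtain ⟨z', rfl⟩ := hsurj z'
    obtain ⟨v, rfl⟩ := hsurj v
    obtain ⟨v', rfl⟩ := hsurj v'
    rw [hh.dist_eq] at hlt ⊢
    rw [hh.dist_eq] at hlt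
    exact H _ _ _ _ (hh.isNearest_image_iff.1 hv) (hh.isNearest_image_iff.1 hv') hlt

theorem IsGeodesicLine.nearestContracting_Ici [ProperSpace X] (hX : IsCAT0 X) {a : ℝ → X}
    (ha : IsGeodesicLine a) {A : ℝ} (hA : 0 < A) (h : NearestContracting A (range a)) (x : ℝ) :
    NearestContracting A (a '' Ici x) := by
  rw [← image_univ] at h
  simpa using h.inter_Ici hX (ha.isoOn univ) ordConnected_univ isClosed_univ hA (mem_univ x)

theorem IsGeodesicLine.nearestContracting_Iic [ProperSpace X] (hX : IsCAT0 X) {a : ℝ → X}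
    (ha : IsGeodesicLine a) {A : ℝ} (hA : 0 < A) (h : NearestContracting A (range a)) (x : ℝ) :
    NearestContracting A (a '' Iic x) := by
  rw [← image_univ] at h
  simpa using h.inter_Iic hX (ha.isoOn univ) ordConnected_univ isClosed_univ hA (mem_univ x)

theorem IsGeodesicLine.nearestContracting_Icc [ProperSpace X] (hX : IsCAT0 X) {a : ℝ → X}
    (ha : IsGeodesicLine a) {A : ℝ} (hA : 0 < A) (h : NearestContracting A (range a)) {x y : ℝ}
    (hxy : x ≤ y) : NearestContracting A (a '' Icc x y) :=
  (ha.nearestContracting_Ici hX hA h x).inter_Iic hX (ha.isoOn _) ordConnected_Ici isClosed_Ici hA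
    hxy

/-- A segment issuing from a contracting line and ending near it is contracting. -/
theorem IsGeodesicLine.nearestContracting_of_endpoint [ProperSpace X] (hX : IsCAT0 X) {a : ℝ → X}
    (ha : IsGeodesicLine a) {A δ : ℝ} (hA : 0 < A) (hδ : 0 ≤ δ)
    (h : NearestContracting A (range a)) {k : ℝ → X} {T t τ : ℝ} (hT : 0 ≤ T)
    (hk : IsoOn k (Icc 0 T)) (h0 : k 0 = a t) (hend : dist (k T) (a τ) ≤ δ) :
    NearestContracting (3 * A + 5 * δ + 1) (k '' Icc 0 T) := by
  have hclose : ∀ l ∈ Icc (0 : ℝ) 1,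
      dist (k ((1 - l) * 0 + l * T)) (a ((1 - l) * t + l * τ)) ≤ δ := by
    intro l hl
    have h1 : (0 : ℝ) ∈ Icc 0 T := ⟨le_rfl, hT⟩
    have h2 : T ∈ Icc 0 T := ⟨hT, le_rfl⟩
    have h3 := (hk.isPt h1 h2 hl (convexComb_mem ordConnected_Icc h1 h2 hl)).dist_le hX hl
      ((ha.isoOn univ).isPt (mem_univ t) (mem_univ τ) hl (mem_univ _))
    rw [h0, dist_self] at h3
    nlinarith [hl.1, hl.2]
  have hab : NearestContracting A (a '' uIcc t τ) :=
    ha.nearestContracting_Icc hX hA h min_le_max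
  refine hab.of_hausdorff hX ((ha.isoOn _).geodConvex ordConnected_uIcc)
    ((ha.isoOn _).exists_isNearest isClosed_Icc nonempty_uIcc) hA hδ ?_ ?_
  · rintro _ ⟨s, hs, rfl⟩
    obtain ⟨l, hl, rfl⟩ : ∃ l ∈ Icc (0 : ℝ) 1, (1 - l) * t + l * τ = s := by
      rw [← segment_eq_uIcc, segment_eq_image] at hs
      simpa using hs
    refine ⟨_, ⟨(1 - l) * 0 + l * T, ?_, rfl⟩, ?_⟩
    · exact convexComb_mem ordConnected_Icc ⟨le_rfl, hT⟩ ⟨hT, le_rfl⟩ hl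
    · rw [dist_comm]; exact hclose l hl
  · rintro _ ⟨s, hs, rfl⟩
    obtain ⟨l, hl, rfl⟩ := exists_convexComb_eq hs.1 hs.2
    refine ⟨_, ⟨(1 - l) * t + l * τ, ?_, rfl⟩, hclose l hl⟩
    exact convexComb_mem ordConnected_uIcc left_mem_uIcc right_mem_uIcc hl

/-- The distance between asymptotic rays is nonincreasing. -/
theorem Asymp.dist_add_le [CompleteSpace X] (hX : IsCAT0 X) {k β : ℝ → X} (hk : IsRay k)
    (hβ : IsRay β) (h : Asymp k β) {T S t : ℝ} (hT : 0 ≤ T) (hS : 0 ≤ S) (ht : 0 ≤ t) :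
    dist (k (T + t)) (β (S + t)) ≤ dist (k T) (β S) := by
  obtain ⟨M, hM⟩ := h
  have hM0 : 0 ≤ M := dist_nonneg.trans (hM 0 le_rfl)
  refine le_of_forall_pos_le_add fun ε hε => ?_
  set E := M + |T - S| with hE
  have hE0 : 0 ≤ E := by positivity
  set L := t + t * E / ε + 1 with hL
  have hL0 : 0 < L := by positivity
  have htL : t ≤ L := by have : 0 ≤ t * E / ε := by positivity
                         linarith
  have hl : t / L ∈ Icc (0 : ℝ) 1 := ⟨by positivity, (div_le_one hL0).2 htL⟩
  have e : ∀ x : ℝ, (1 - t / L) * x + t / L * (x + L) = x + t := by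
    intro x; field_simp; ring
  have hp : ∀ {c : ℝ → X} {x : ℝ}, IsRay c → 0 ≤ x →
      IsPt (t / L) (c x) (c (x + L)) (c (x + t)) := by
    intro c x hc hx
    rw [← e x]
    refine hc.isoOn.isPt hx (add_nonneg hx hL0.le) hl ?_
    rw [e x]
    exact add_nonneg hx ht
  have h1 := (hp hk hT).dist_le hX hl (hp hβ hS)
  have h2 : dist (k (T + L)) (β (S + L)) ≤ E := by
    have h3 := hM (T + L) (by positivity)
    have h4 := hβ (T + L) (S + L) (by positivity) (by positivity)
    rw [show T + L - (S + L) = T - S by ring] at h4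
    linarith [dist_triangle (k (T + L)) (β (T + L)) (β (S + L))]
  have h5 : t / L * E ≤ ε := by
    rw [div_mul_eq_mul_div, div_le_iff₀ hL0]
    have : ε * L = ε * t + t * E + ε := by rw [hL]; field_simp
    nlinarith [mul_nonneg hε.le ht]
  have h6 := mul_le_mul_of_nonneg_left h2 hl.1
  nlinarith [mul_nonneg hl.1 (dist_nonneg (x := k T) (y := β S))]

/-- A ray asymptotic to a contracting ray which starts near it is contracting. -/
theorem NearestContracting.of_asymp [ProperSpace X] (hX : IsCAT0 X) {k β : ℝ → X} (hk : IsRay k)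
    (hβ : IsRay β) (h : Asymp k β) {B T S d : ℝ} (hB : 0 < B) (hT : 0 ≤ T) (hS : 0 ≤ S)
    (hd : dist (k T) (β S) ≤ d) (hcon : NearestContracting B (β '' Ici 0)) :
    NearestContracting (3 * B + 5 * d + 1) (k '' Ici T) := by
  have hsub : Ici S ⊆ Ici (0 : ℝ) := Ici_subset_Ici.2 hS
  have htail : NearestContracting B (β '' Ici S) := by
    have := hcon.inter_Ici hX hβ.isoOn ordConnected_Ici isClosed_Ici hB (α := S) hS
    rwa [inter_eq_right.2 hsub] at this
  have hclose : ∀ t, 0 ≤ t → dist (k (T + t)) (β (S + t)) ≤ d := fun t ht =>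
    (h.dist_add_le hX hk hβ hT hS ht).trans hd
  refine htail.of_hausdorff hX ((hβ.isoOn.mono hsub).geodConvex ordConnected_Ici)
    ((hβ.isoOn.mono hsub).exists_isNearest isClosed_Ici nonempty_Ici) hB
    (dist_nonneg.trans hd) ?_ ?_
  · rintro _ ⟨s, hs, rfl⟩
    have hs' : 0 ≤ s - S := sub_nonneg.2 hs
    refine ⟨_, ⟨T + (s - S), by simpa using hs', rfl⟩, ?_⟩
    have := hclose (s - S) hs'
    rwa [dist_comm, add_sub_cancel] at this
  · rintro _ ⟨s, hs, rfl⟩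
    have hs' : 0 ≤ s - T := sub_nonneg.2 hs
    refine ⟨_, ⟨S + (s - T), by simpa using hs', rfl⟩, ?_⟩
    have := hclose (s - T) hs'
    rwa [add_sub_cancel] at this

theorem IsRay.nearestContracting_of_unbounded {k : ℝ → X} {C : ℝ}
    (h : ∀ R, ∃ T, R < T ∧ NearestContracting C (k '' Icc 0 T)) :
    NearestContracting C (k '' Ici 0) := by
  rintro z z' _ _ hz hz' hlt
  obtain ⟨t, ht, rfl⟩ := hz.1
  obtain ⟨t', ht', rfl⟩ := hz'.1
  obtain ⟨T, hT, hcon⟩ := h (max t t')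
  have hsub : k '' Icc 0 T ⊆ k '' Ici 0 := image_mono Icc_subset_Ici_self
  exact hcon z z' _ _ (hz.mono hsub ⟨t, ⟨ht, (le_max_left _ _).trans hT.le⟩, rfl⟩)
    (hz'.mono hsub ⟨t', ⟨ht', (le_max_right _ _).trans hT.le⟩, rfl⟩) hlt

theorem SlimSet.nonneg {δ : ℝ} {S : Set X} (h : SlimSet δ S) (hne : S.Nonempty) : 0 ≤ δ := by
  obtain ⟨π, -, hs⟩ := h
  obtain ⟨x, hx⟩ := hne
  obtain ⟨s, -, hd⟩ := hs x x hx (fun _ => x) ⟨rfl, rfl, fun s t hs ht => by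
    simp only [dist_self, Icc_self, mem_singleton_iff] at hs ht
    simp [hs, ht]⟩
  exact dist_nonneg.trans hd

theorem IsRay.isGeodesicSeg_rev {k : ℝ → X} (hk : IsRay k) {N : ℝ} (hN : 0 ≤ N) :
    dist (k N) (k 0) = N ∧ IsGeodesicSeg (fun s => k (N - s)) (k N) (k 0) := by
  have hd : dist (k N) (k 0) = N := by rw [hk N 0 hN le_rfl, sub_zero, abs_of_nonneg hN]
  refine ⟨hd, by simp, by simp [hd], fun s t hs ht => ?_⟩
  rw [hd] at hs ht
  simp only [hk _ _ (sub_nonneg.2 hs.2) (sub_nonneg.2 ht.2)]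
  rw [abs_sub_comm]
  congr 1
  ring

/-- A ray issuing from a contracting slim line and asymptotic to a contracting ray issuing from
the same line is contracting. -/
theorem nearestContracting_of_asymp_of_line [ProperSpace X] (hX : IsCAT0 X) {a : ℝ → X}
    (ha : IsGeodesicLine a) {A δ : ℝ} (hA0 : 0 < A) (hA : NearestContracting A (range a))
    (hslim : SlimSet δ (range a)) {k β : ℝ → X} (hk : IsRay k) (hβ : IsRay β) {B : ℝ}
    (hB0 : 0 < B) (hB : NearestContracting B (β '' Ici 0)) (hkβ : Asymp k β)
    (hk0 : k 0 ∈ range a) (hβ0 : β 0 ∈ range a) :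
    NearestContracting (3 * A + 3 * B + 15 * δ + 7) (k '' Ici 0) := by
  have hδ : 0 ≤ δ := hslim.nonneg (range_nonempty a)
  obtain ⟨π, hπ, hsl⟩ := hslim
  obtain ⟨t₀, ht₀⟩ := hk0
  have hnear : ∀ N, 0 ≤ N → ∃ T, 0 ≤ T ∧ dist (π (k N)) (k T) ≤ δ := by
    intro N hN
    obtain ⟨hd, hseg⟩ := hk.isGeodesicSeg_rev hN
    obtain ⟨s, hs, hsd⟩ := hsl (k N) (k 0) ⟨t₀, ht₀⟩ _ hseg
    exact ⟨N - s, by linarith [hs.2], hsd⟩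
  have hinit : ∀ N T, 0 ≤ T → dist (π (k N)) (k T) ≤ δ →
      NearestContracting (3 * A + 5 * δ + 1) (k '' Icc 0 T) := by
    intro N T hT hd
    obtain ⟨τ, hτ⟩ := (hπ (k N)).1
    rw [← hτ, dist_comm] at hd
    exact ha.nearestContracting_of_endpoint hX hA0 hδ hA hT (hk.isoOn.mono Icc_subset_Ici_self)
      ht₀.symm hd
  by_cases hbdd : ∃ R, ∀ N T, 0 ≤ N → 0 ≤ T → dist (π (k N)) (k T) ≤ δ → T ≤ R
  swap
  · push Not at hbdd
    refine (IsRay.nearestContracting_of_unbounded fun R => ?_).mono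
      (by linarith : 3 * A + 5 * δ + 1 ≤ _)
    obtain ⟨N, T, -, hT, hd, hR⟩ := hbdd R
    exact ⟨T, hR, hinit N T hT hd⟩
  obtain ⟨R, hR⟩ := hbdd
  obtain ⟨M, hM⟩ := id hkβ
  have hM0 : 0 ≤ M := dist_nonneg.trans (hM 0 le_rfl)
  obtain ⟨T₀, hT₀, hdT₀⟩ := hnear 0 le_rfl
  have hR0 : 0 ≤ R := hT₀.trans (hR 0 T₀ le_rfl hT₀ hdT₀)
  set R' := M + R + 2 * δ with hR'
  have hR'0 : 0 ≤ R' := by positivity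
  set N := M + 2 * M * R' + 1 with hN
  have hN0 : 0 ≤ N := by positivity
  obtain ⟨T, hT, hdT⟩ := hnear N hN0
  have hTR := hR N T hN0 hT hdT
  obtain ⟨σ, hσ0, hσ1, hσ⟩ := hX.exists_geodesicSeg (k N) (β 0)
  obtain ⟨s, hs, hds⟩ := hsl (k N) (β 0) hβ0 σ ⟨hσ0, hσ1, hσ⟩
  set D := dist (k N) (β 0) with hD
  have hβN : dist (β N) (β 0) = N := (hβ.isGeodesicSeg_rev hN0).1
  have hkN : dist (k N) (β N) ≤ M := hM N hN0
  have hD1 : N - M ≤ D := by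
    linarith [dist_triangle_left (β N) (β 0) (k N)]
  have hD2 : D ≤ N + M := by
    linarith [dist_triangle (k N) (β N) (β 0)]
  have hDpos : 0 < D := by
    have : 0 ≤ 2 * M * R' := by positivity
    linarith
  have hse : dist (σ s) (β 0) = D - s := by
    rw [← hσ1, hσ s D hs ⟨hDpos.le, le_rfl⟩, abs_of_nonpos (by linarith [hs.2])]
    ring
  have hes : dist (k N) (σ s) = s := by
    have := hσ 0 s ⟨le_rfl, hDpos.le⟩ hs
    rw [hσ0] at this
    rw [this, abs_of_nonpos (by linarith [hs.1])]
    ring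
  have hS0 : 0 ≤ D - s := by linarith [hs.2]
  have hSR : D - s ≤ R' := by
    have h1 := hk.isGeodesicSeg_rev hT |>.1
    have h2 := dist_triangle4 (σ s) (π (k N)) (k T) (β 0)
    have h3 := dist_triangle (k T) (k 0) (β 0)
    have h4 := hM 0 le_rfl
    rw [dist_comm (σ s) (π (k N))] at h2
    linarith
  have hl : (D - s) / D ∈ Icc (0 : ℝ) 1 :=
    ⟨by positivity, (div_le_one hDpos).2 (by linarith [hs.1])⟩
  have hp1 : IsPt ((D - s) / D) (β 0) (k N) (σ s) := by
    constructor
    · rw [dist_comm, hse, dist_comm (β 0), ← hD]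
      field_simp
      exact le_rfl
    · rw [dist_comm, hes, dist_comm (β 0), ← hD]
      field_simp
      linarith
  have hβD : dist (β 0) (β D) = D := by
    rw [dist_comm]; exact (hβ.isGeodesicSeg_rev hDpos.le).1
  have hp2 : IsPt ((D - s) / D) (β 0) (β D) (β (D - s)) := by
    constructor
    · rw [dist_comm, (hβ.isGeodesicSeg_rev hS0).1, hβD]
      field_simp
      exact le_rfl
    · rw [hβ _ _ hS0 hDpos.le, hβD, abs_of_nonpos (by linarith [hs.1])]
      field_simp
      linarith
  have hes2 : dist (σ s) (β (D - s)) ≤ 1 := by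
    refine (hp1.dist_le_of_left hX hl hp2).trans ?_
    have h1 : dist (k N) (β D) ≤ 2 * M := by
      have h2 := hβ N D hN0 hDpos.le
      have h3 : |N - D| ≤ M := abs_le.2 ⟨by linarith, by linarith⟩
      linarith [dist_triangle (k N) (β N) (β D)]
    rw [div_mul_eq_mul_div, div_le_one hDpos]
    calc (D - s) * dist (k N) (β D) ≤ R' * (2 * M) := by gcongr
      _ ≤ D := by linarith
  have hstart : dist (k T) (β (D - s)) ≤ 2 * δ + 1 := by
    have := dist_triangle4 (k T) (π (k N)) (σ s) (β (D - s))
    rw [dist_comm (k T) (π (k N))] at this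
    linarith
  have htail := hB.of_asymp hX hk hβ hkβ hB0 hT hS0 hstart
  have hhead := hinit N T hT hdT
  rw [← Ici_inter_Iic] at hhead
  rw [← inter_eq_right.2 (Ici_subset_Ici.2 hT)] at htail
  exact (NearestContracting.concat hX hk.isoOn ordConnected_Ici hT hhead htail).mono
    (by linarith)

/-- A ray issuing from a point of a line has a positive contraction constant. -/
theorem NearestContracting.pos_of_ray [ProperSpace X] {a : ℝ → X} (ha : IsGeodesicLine a)
    {c : ℝ → X} (hc : IsRay c) (h0 : c 0 ∈ range a) {C : ℝ}
    (h : NearestContracting C (c '' Ici 0)) : 0 < C := by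
  by_contra! hC
  have hall : ∀ z, z ∈ c '' Ici 0 := by
    intro z
    obtain ⟨v, hv⟩ := hc.isoOn.exists_isNearest isClosed_Ici nonempty_Ici z
    rcases eq_or_ne z v with rfl | hne
    · exact hv.1
    · have := h z z v v hv hv (by simpa using hne)
      rw [dist_self] at this
      linarith
  obtain ⟨t, ht⟩ := h0
  obtain ⟨r, hr, hr'⟩ := hall (a (t + 1))
  obtain ⟨s, hs, hs'⟩ := hall (a (t - 1))
  have h1 := hc r 0 hr le_rfl
  have h2 := hc s 0 hs le_rfl
  have h3 := hc r s hr hs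
  rw [hr', ← ht, ha] at h1
  rw [hs', ← ht, ha] at h2
  rw [hr', hs', ha] at h3
  norm_num [abs_of_nonneg (mem_Ici.1 hr), abs_of_nonneg (mem_Ici.1 hs)] at h1 h2 h3
  rw [← h1, ← h2] at h3
  norm_num at h3

/-- In a space consisting of a single line, rays are contracting with every positive constant. -/
theorem IsRay.nearestContracting_of_range_eq_univ [ProperSpace X] (hX : IsCAT0 X) {a : ℝ → X}
    (ha : IsGeodesicLine a) (huniv : ∀ x, x ∈ range a) {b : ℝ → X} (hb : IsRay b)
    (h0 : b 0 = a 0) {C : ℝ} (hC : 0 < C) : NearestContracting C (b '' Ici 0) := by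
  have hline : NearestContracting C (range a) := by
    intro z z' v v' hv _ hlt
    have := hv.2 z (huniv z)
    rw [dist_self] at this
    linarith [dist_nonneg (x := z) (y := z')]
  choose τ hτ using fun t => huniv (b t)
  have hτ0 : ∀ t, 0 ≤ t → |τ t| = t := by
    intro t ht
    have := hb t 0 ht le_rfl
    rwa [h0, ← hτ t, ha, sub_zero, sub_zero, abs_of_nonneg ht] at this
  have hτ1 : ∀ t, 0 ≤ t → |τ t - τ 1| = |t - 1| := by
    intro t ht
    have := hb t 1 ht zero_le_one
    rwa [← hτ t, ← hτ 1, ha] at this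
  rcases eq_or_eq_neg_of_abs_eq (hτ0 1 zero_le_one) with h1 | h1
  · have : b '' Ici 0 = a '' Ici 0 := by
      refine image_congr fun t ht => ?_
      have h2 := hτ1 t ht
      have h3 := hτ0 t ht
      rw [h1] at h2
      rw [← hτ t]
      congr 1
      rcases eq_or_eq_neg_of_abs_eq h3 with h4 | h4
      · exact h4
      · rw [h4] at h2
        have := sq_abs (-t - 1)
        rw [h2, sq_abs] at this
        linarith
    rw [this]
    exact ha.nearestContracting_Ici hX hC hline 0
  · have : b '' Ici 0 = a '' Iic 0 := by
      have e : b '' Ici 0 = (fun t => a (-t)) '' Ici 0 := by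
        refine image_congr fun t ht => ?_
        have h2 := hτ1 t ht
        have h3 := hτ0 t ht
        rw [h1] at h2
        rw [← hτ t]
        congr 1
        rcases eq_or_eq_neg_of_abs_eq h3 with h4 | h4
        · rw [h4] at h2
          have := sq_abs (t - -1)
          rw [h2, sq_abs] at this
          linarith
        · exact h4
      rw [e, ← image_comp_neg a (Iic 0)]
      simp
    rw [this]
    exact ha.nearestContracting_Iic hX hC hline 0

end Rays

theorem rank_one_coarsely_preserves_constants [ProperSpace X] (hX : IsCAT0 X)
    (g : X → X) (hg : Isometry g) (hsurj : Function.Surjective g)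
    (a : ℝ → X) (ha : IsGeodesicLine a) (ℓ : ℝ) (hℓ : 0 < ℓ)
    (haxis : ∀ t : ℝ, g (a t) = a (t + ℓ))
    (A δA : ℝ) (hA : ContractingSet A (range a)) (hslim : SlimSet δA (range a))
    (p : X) (hp : a 0 = p)
    (b : ℝ → X) (hb : IsRay b) (hb0 : b 0 = p)
    (B : ℝ) (hB : ContractingSet B (b '' Ici (0:ℝ)))
    (Btil : ℝ) (hBtil : IsLeast {B' : ℝ | ContractingSet B' (b '' Ici (0:ℝ))} Btil) :
    ∀ n : ℕ, ∀ k : ℝ → X, IsRay k → k 0 = p →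
      Asymp k (fun t => g^[n] (b t)) →
      ContractingSet ((16 * A + 28 * 0 + 7 * (2 * δA) + 10) +
          (16 * B + 28 * (2 * δA) + 7 * 0 + 10)) (k '' Ici (0:ℝ)) ∧
      ∀ K : ℝ, ContractingSet K (k '' Ici (0:ℝ)) →
        (Btil - 16 * A - 77 * δA - 38) / 16 - 3 ≤ K := by

  intro n k hk hk0 hkb
  have hex : ∀ {c : ℝ → X}, IsRay c → ∀ z, ∃ v, IsNearest (c '' Ici 0) z v := fun hc =>
    hc.isoOn.exists_isNearest isClosed_Ici nonempty_Ici
  have hcon : ∀ {c : ℝ → X} {C : ℝ}, IsRay c → ContractingSet C (c '' Ici 0) →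
      NearestContracting C (c '' Ici 0) := fun hc h =>
    h.nearestContracting hX (hc.isoOn.geodConvex ordConnected_Ici)
  have hδ : 0 ≤ δA := hslim.nonneg (range_nonempty a)
  have hpa : p ∈ range a := ⟨0, hp⟩
  have hB' := hcon hb hB
  have hB0 : 0 < B := hB'.pos_of_ray ha hb (hb0 ▸ hpa)
  have hBtil0 : 0 < Btil := (hcon hb hBtil.1).pos_of_ray ha hb (hb0 ▸ hpa)
  have hA' : NearestContracting A (range a) := by
    refine hA.nearestContracting hX ?_
    rw [← image_univ]
    exact (ha.isoOn univ).geodConvex ordConnected_univ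
  have hA0 : 0 < A := by
    by_contra! hneg
    have huniv : ∀ x, x ∈ range a := by
      intro x
      obtain ⟨v, hv⟩ := (ha.isoOn univ).exists_isNearest isClosed_univ univ_nonempty x
      rw [image_univ] at hv
      rcases eq_or_ne x v with rfl | hne
      · exact hv.1
      · have := hA' x x v v hv hv (by simpa using hne)
        rw [dist_self] at this
        linarith
    have hhalf := hb.nearestContracting_of_range_eq_univ hX ha huniv (hb0.trans hp.symm)
      (half_pos hBtil0)
    linarith [hBtil.2 (hhalf.contractingSet (hex hb))]
  have hgn : Isometry g^[n] := by
    clear hkb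
    induction n with
    | zero => exact isometry_id
    | succ n ih => rw [Function.iterate_succ]; exact ih.comp hg
  have hgs : Function.Surjective g^[n] := hsurj.iterate n
  have hga : ∀ m : ℕ, ∀ t, g^[m] (a t) ∈ range a := by
    intro m
    induction m with
    | zero => exact fun t => ⟨t, rfl⟩
    | succ m ih => intro t; rw [Function.iterate_succ_apply, haxis]; exact ih _
  have himg : (fun t => g^[n] (b t)) '' Ici 0 = g^[n] '' (b '' Ici 0) := by rw [image_image]
  have hβ : IsRay (fun t => g^[n] (b t)) := hgn.isRay hb
  have hβ0 : (fun t => g^[n] (b t)) 0 ∈ range a := by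
    simp only [hb0, ← hp]
    exact hga n 0
  have hk0' : k 0 ∈ range a := hk0 ▸ hpa
  constructor
  · have hBβ : NearestContracting B ((fun t => g^[n] (b t)) '' Ici 0) := by
      rw [himg]
      exact (hgn.nearestContracting_image_iff hgs).2 hB'
    have := nearestContracting_of_asymp_of_line hX ha hA0 hA' hslim hk hβ hB0 hBβ hkb hk0' hβ0
    exact (this.mono (by linarith)).contractingSet (hex hk)
  · intro K hK
    have hK' := hcon hk hK
    have hK0 : 0 < K := hK'.pos_of_ray ha hk hk0'
    have := nearestContracting_of_asymp_of_line hX ha hA0 hA' hslim hβ hk hK0 hK' hkb.symm hβ0 hk0'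
    rw [himg, hgn.nearestContracting_image_iff hgs] at this
    have hle := hBtil.2 (this.contractingSet (hex hb))
    linarith
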